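/- Let T : ℋⁿ → ℋⁿ be an ℝ-linear map and q ∈ (ℝⁿ₊)↓. Then λ(|T(X)|) ≺_w q*λ(|X|) holds for all X ∈ ℋⁿ if and only if λ(|T*(X)|) ≺_w q*λ(|X|) holds for all X ∈ ℋⁿ. -/

import Mathlib

open Matrix
open scoped ComplexOrder

/-- Sum of the `k` largest entries of `p` (as a supremum of sums over `k`-subsets). -/
noncomputable def sumLargest {n : ℕ} (p : Fin n → ℝ) (k : ℕ) : ℝ :=
  sSup ((fun A : Finset (Fin n) => ∑ i ∈ A, p i) '' {A : Finset (Fin n) | A.card = k})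

/-- `p` is weakly majorized by `q`. -/
def WeakMaj {n : ℕ} (p q : Fin n → ℝ) : Prop :=
  ∀ k : ℕ, 1 ≤ k → k ≤ n → sumLargest p k ≤ sumLargest q k

/-- `p` is majorized by `q`. -/
def Maj {n : ℕ} (p q : Fin n → ℝ) : Prop :=
  WeakMaj p q ∧ ∑ i, p i = ∑ i, q i

/-- `p` has nonnegative entries arranged in decreasing order. -/
def DecrNonneg {n : ℕ} (p : Fin n → ℝ) : Prop :=
  Antitone p ∧ ∀ i, 0 ≤ p i

/-- The decreasing rearrangement of a vector. -/
noncomputable def decrRearrange {n : ℕ} (p : Fin n → ℝ) : Fin n → ℝ :=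
  fun i => p (Tuple.sort p (Fin.rev i))

/-- `x` is the supremum of `S` in the weak-majorization order (w-sup). -/
def IsWSup {n : ℕ} (S : Set (Fin n → ℝ)) (x : Fin n → ℝ) : Prop :=
  DecrNonneg x ∧ (∀ s ∈ S, WeakMaj s x) ∧
    ∀ p : Fin n → ℝ, (∀ i, 0 ≤ p i) → (∀ s ∈ S, WeakMaj s p) → WeakMaj x p

/-- `x` is the infimum of `Q` in the weak-majorization order (w-inf). -/
def IsWInf {n : ℕ} (Q : Set (Fin n → ℝ)) (x : Fin n → ℝ) : Prop :=
  DecrNonneg x ∧ (∀ q ∈ Q, WeakMaj x q) ∧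
    ∀ p : Fin n → ℝ, (∀ i, 0 ≤ p i) → (∀ q ∈ Q, WeakMaj p q) → WeakMaj p x

open Classical in
/-- The vector of eigenvalues of a Hermitian matrix, in decreasing order
(junk value `0` if the matrix is not Hermitian). -/
noncomputable def specVec {n : ℕ} (X : Matrix (Fin n) (Fin n) ℂ) : Fin n → ℝ :=
  if h : X.IsHermitian then decrRearrange h.eigenvalues else 0

open Classical in
/-- `λ(|X|)`: the absolute values of the eigenvalues of a Hermitian matrix `X`,
in decreasing order. -/
noncomputable def absSpecVec {n : ℕ} (X : Matrix (Fin n) (Fin n) ℂ) : Fin n → ℝ :=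
  if h : X.IsHermitian then decrRearrange (fun i => |h.eigenvalues i|) else 0

/-- The Jordan product `X ∘ Y = (XY + YX)/2`. -/
noncomputable def jmul {n : ℕ} (X Y : Matrix (Fin n) (Fin n) ℂ) : Matrix (Fin n) (Fin n) ℂ :=
  (2 : ℂ)⁻¹ • (X * Y + Y * X)

/-- A nonzero (orthogonal) projection in `ℋⁿ`. -/
def IsProjection {n : ℕ} (P : Matrix (Fin n) (Fin n) ℂ) : Prop :=
  P.IsHermitian ∧ P * P = P ∧ P ≠ 0

/-- An involution in `ℋⁿ`: a Hermitian matrix with `ε² = I`. -/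
def IsInvolution {n : ℕ} (ε : Matrix (Fin n) (Fin n) ℂ) : Prop :=
  ε.IsHermitian ∧ ε * ε = 1

/-- A positive map: maps positive semidefinite matrices to positive semidefinite matrices. -/
def PositiveMap {n : ℕ} (T : Matrix (Fin n) (Fin n) ℂ → Matrix (Fin n) (Fin n) ℂ) : Prop :=
  ∀ X : Matrix (Fin n) (Fin n) ℂ, X.PosSemidef → (T X).PosSemidef

/-- `S` is the adjoint of `T` with respect to the trace inner product on `ℋⁿ`. -/
def IsAdjointOf {n : ℕ} (S T : Matrix (Fin n) (Fin n) ℂ → Matrix (Fin n) (Fin n) ℂ) : Prop :=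
  ∀ X Y : Matrix (Fin n) (Fin n) ℂ, X.IsHermitian → Y.IsHermitian →
    Matrix.trace (T X * Y) = Matrix.trace (X * S Y)

/-- `q` is the least vector of `T`: `λ(|T(X)|) ≺_w q * λ(|X|)` for all Hermitian `X`,
and `q ≺_w q'` for any other `q' ∈ (ℝⁿ₊)↓` with the same property. -/
def IsLeastVector {n : ℕ} (T : Matrix (Fin n) (Fin n) ℂ → Matrix (Fin n) (Fin n) ℂ)
    (q : Fin n → ℝ) : Prop :=
  DecrNonneg q ∧
  (∀ X : Matrix (Fin n) (Fin n) ℂ, X.IsHermitian →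
    WeakMaj (absSpecVec (T X)) (q * absSpecVec X)) ∧
  ∀ q' : Fin n → ℝ, DecrNonneg q' →
    (∀ X : Matrix (Fin n) (Fin n) ℂ, X.IsHermitian →
      WeakMaj (absSpecVec (T X)) (q' * absSpecVec X)) → WeakMaj q q'

section WeakMajorization

variable {n : ℕ}

lemma sum_le_sumLargest (p : Fin n → ℝ) (A : Finset (Fin n)) :
    ∑ i ∈ A, p i ≤ sumLargest p A.card :=
  le_csSup (Set.toFinite _).bddAbove ⟨A, rfl, rfl⟩

lemma sumLargest_le {p : Fin n → ℝ} {k : ℕ} (hk : k ≤ n) {c : ℝ}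
    (h : ∀ A : Finset (Fin n), A.card = k → ∑ i ∈ A, p i ≤ c) : sumLargest p k ≤ c := by
  refine csSup_le ?_ ?_
  · obtain ⟨A, -, hA⟩ := Finset.exists_subset_card_eq
      (s := (Finset.univ : Finset (Fin n))) (n := k) (by simpa using hk)
    exact ⟨_, A, hA, rfl⟩
  · rintro _ ⟨A, hA, rfl⟩
    exact h A hA

/-- The initial segment of length `k` in `Fin n`. -/
def initialSegment (n k : ℕ) : Finset (Fin n) := {i | (i : ℕ) < k}

lemma card_initialSegment {k : ℕ} (hk : k ≤ n) : (initialSegment n k).card = k := by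
  simp [initialSegment, Fin.card_filter_val_lt, hk]

/-- For a decreasing vector the `k` largest entries are the first `k` ones. -/
lemma sumLargest_le_sum_initialSegment {p : Fin n → ℝ} (hp : Antitone p) {k : ℕ}
    (hk1 : 1 ≤ k) (hk : k ≤ n) : sumLargest p k ≤ ∑ i ∈ initialSegment n k, p i := by
  refine sumLargest_le hk fun A hA => ?_
  let c : ℝ := p ⟨k - 1, by omega⟩
  have hle : ∑ i ∈ A, (p i - c) ≤ ∑ i ∈ initialSegment n k, (p i - c) := by
    calc ∑ i ∈ A, (p i - c)
        ≤ ∑ i ∈ A, if (i : ℕ) < k then p i - c else 0 := by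
          refine Finset.sum_le_sum fun i _ => ?_
          split_ifs with h
          · exact le_rfl
          · exact sub_nonpos.2 (hp (Fin.le_def.2 (by simp only; omega)))
      _ ≤ ∑ i : Fin n, if (i : ℕ) < k then p i - c else 0 := by
          refine Finset.sum_le_univ_sum_of_nonneg fun i => ?_
          split_ifs with h
          · exact sub_nonneg.2 (hp (Fin.le_def.2 (by simp only; omega)))
          · exact le_rfl
      _ = _ := by rw [initialSegment, Finset.sum_filter]
  simpa [Finset.sum_sub_distrib, hA, card_initialSegment hk] using hle

/-- Abel summation: pairing a decreasing nonnegative sequence with a sequence whose partial sums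
are nonnegative gives a nonnegative sum. -/
lemma sum_range_mul_nonneg_of_partial_sums {y w : ℕ → ℝ} (n : ℕ) (hy : Antitone y)
    (hy0 : ∀ i, 0 ≤ y i) (hw : ∀ k ≤ n, 0 ≤ ∑ i ∈ Finset.range k, w i) :
    0 ≤ ∑ i ∈ Finset.range n, y i * w i := by
  suffices h : y n * ∑ i ∈ Finset.range n, w i ≤ ∑ i ∈ Finset.range n, y i * w i from
    (mul_nonneg (hy0 n) (hw n le_rfl)).trans h
  induction n with
  | zero => simp
  | succ m ih =>
    have h1 := ih fun k hk => hw k (hk.trans m.le_succ)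
    have h2 := mul_le_mul_of_nonneg_right (hy m.le_succ) (hw (m + 1) le_rfl)
    rw [Finset.sum_range_succ] at h2 ⊢
    rw [Finset.sum_range_succ]
    linarith

lemma sum_mul_le_sum_mul_of_weakMaj {x z y : Fin n → ℝ} (hz : Antitone z) (hy : DecrNonneg y)
    (h : WeakMaj x z) : ∑ i, x i * y i ≤ ∑ i, z i * y i := by
  let Y : ℕ → ℝ := fun i => if hi : i < n then y ⟨i, hi⟩ else 0
  let w : ℕ → ℝ := fun i => if hi : i < n then z ⟨i, hi⟩ - x ⟨i, hi⟩ else 0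
  have hY0 : ∀ i, 0 ≤ Y i := fun i => by
    simp only [Y]
    split_ifs
    exacts [hy.2 _, le_rfl]
  have hY : Antitone Y := fun i j hij => by
    by_cases hj : j < n
    · simp only [Y, hj, hij.trans_lt hj, dif_pos]
      exact hy.1 (Fin.le_def.2 hij)
    · simpa only [Y, hj, dif_neg, not_false_iff] using hY0 i
  have hw : ∀ k ≤ n, 0 ≤ ∑ i ∈ Finset.range k, w i := fun k hk => by
    rcases Nat.eq_zero_or_pos k with rfl | hk0
    · simp
    have hx := sum_le_sumLargest x (initialSegment n k)
    rw [card_initialSegment hk] at hx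
    have hsum := hx.trans ((h k hk0 hk).trans (sumLargest_le_sum_initialSegment hz hk0 hk))
    have heq : ∑ i ∈ Finset.range k, w i = ∑ i ∈ initialSegment n k, (z i - x i) := by
      rw [initialSegment, Finset.sum_filter]
      have := Fin.sum_univ_eq_sum_range (fun i => if i < k then w i else 0) n
      simp only [w, Fin.is_lt, dif_pos, Fin.eta] at this
      rw [this, ← Finset.sum_filter]
      congr 1
      ext i
      simp only [Finset.mem_range, Finset.mem_filter]
      omega
    rw [heq, Finset.sum_sub_distrib]
    linarith
  have key := sum_range_mul_nonneg_of_partial_sums n hY hY0 hw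
  rw [← Fin.sum_univ_eq_sum_range (fun i => Y i * w i) n] at key
  simp only [Y, w, Fin.is_lt, dif_pos, Fin.eta, mul_sub, Finset.sum_sub_distrib] at key
  simp only [mul_comm (y _)] at key
  linarith

lemma sum_mul_le_sumLargest {p y : Fin n → ℝ} {k : ℕ} (hk : k ≤ n) (hp : ∀ i, 0 ≤ p i)
    (hy : ∀ i, y i ≤ 1) (hcard : (Finset.univ.filter fun i => y i ≠ 0).card ≤ k) :
    ∑ i, p i * y i ≤ sumLargest p k := by
  obtain ⟨B, hB, -, hBk⟩ := Finset.exists_subsuperset_card_eq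
    (Finset.subset_univ (Finset.univ.filter fun i => y i ≠ 0)) hcard (by simpa using hk)
  calc ∑ i, p i * y i = ∑ i ∈ B, p i * y i := by
        refine (Finset.sum_subset (Finset.subset_univ B) fun i _ hi => ?_).symm
        have : y i = 0 := by
          by_contra h0
          exact hi (hB (by simpa using h0))
        simp [this]
    _ ≤ ∑ i ∈ B, p i := Finset.sum_le_sum fun i _ => mul_le_of_le_one_right (hp i) (hy i)
    _ ≤ sumLargest p k := hBk ▸ sum_le_sumLargest p B

lemma decrRearrange_antitone (p : Fin n → ℝ) : Antitone (decrRearrange p) :=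
  fun _ _ hij => Tuple.monotone_sort p (Fin.rev_le_rev.2 hij)

lemma exists_perm_decrRearrange (p : Fin n → ℝ) :
    ∃ σ : Equiv.Perm (Fin n), ∀ i, decrRearrange p i = p (σ i) :=
  ⟨Fin.revPerm.trans (Tuple.sort p), fun _ => rfl⟩

lemma absSpecVec_eq {X : Matrix (Fin n) (Fin n) ℂ} (hX : X.IsHermitian) :
    absSpecVec X = decrRearrange fun i => |hX.eigenvalues i| := dif_pos hX

lemma exists_perm_absSpecVec {X : Matrix (Fin n) (Fin n) ℂ} (hX : X.IsHermitian) :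
    ∃ σ : Equiv.Perm (Fin n), ∀ i, absSpecVec X i = |hX.eigenvalues (σ i)| := by
  rw [absSpecVec_eq hX]
  exact exists_perm_decrRearrange _

lemma decrNonneg_absSpecVec {X : Matrix (Fin n) (Fin n) ℂ} (hX : X.IsHermitian) :
    DecrNonneg (absSpecVec X) := by
  refine ⟨absSpecVec_eq hX ▸ decrRearrange_antitone _, fun i => ?_⟩
  obtain ⟨σ, hσ⟩ := exists_perm_absSpecVec hX
  rw [hσ]
  exact abs_nonneg _

lemma DecrNonneg.mul {p q : Fin n → ℝ} (hp : DecrNonneg p) (hq : DecrNonneg q) :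
    DecrNonneg (p * q) :=
  ⟨fun i j hij => mul_le_mul (hp.1 hij) (hq.1 hij) (hq.2 j) (hp.2 i),
    fun i => mul_nonneg (hp.2 i) (hq.2 i)⟩

/-- Rearrangement inequality for a doubly stochastic coupling. -/
lemma sum_doublyStochastic_le_of_decrRearrange {D : Matrix (Fin n) (Fin n) ℝ}
    (hD : D ∈ doublyStochastic ℝ (Fin n)) (a b : Fin n → ℝ) :
    ∑ i, ∑ j, a i * D i j * b j ≤ ∑ i, decrRearrange a i * decrRearrange b i := by
  obtain ⟨w, hw0, hw1, rfl⟩ := exists_eq_sum_perm_of_mem_doublyStochastic hD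
  obtain ⟨σ, hσ⟩ := exists_perm_decrRearrange a
  obtain ⟨τ, hτ⟩ := exists_perm_decrRearrange b
  have hperm : ∀ π : Equiv.Perm (Fin n),
      ∑ i, a i * b (π i) ≤ ∑ i, decrRearrange a i * decrRearrange b i := fun π => by
    have hmono : Monovary (decrRearrange a) (decrRearrange b) :=
      (decrRearrange_antitone a).monovary (decrRearrange_antitone b)
    have := hmono.sum_mul_comp_perm_le_sum_mul (σ := (σ.trans π).trans τ.symm)
    refine le_trans (le_of_eq ?_) this
    rw [← Equiv.sum_comp σ]
    simp [hσ, hτ]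
  calc ∑ i, ∑ j, a i * (∑ π, w π • π.permMatrix ℝ) i j * b j
      = ∑ π, w π * ∑ i, a i * b (π i) := by
        simp only [Matrix.sum_apply, Matrix.smul_apply, Equiv.Perm.permMatrix,
          PEquiv.toMatrix_apply, Equiv.toPEquiv_apply, Option.mem_def, Option.some.injEq,
          smul_eq_mul, Finset.mul_sum, Finset.sum_mul]
        rw [Finset.sum_comm (s := (Finset.univ : Finset (Equiv.Perm (Fin n))))]
        refine Finset.sum_congr rfl fun i _ => ?_
        rw [Finset.sum_comm]
        refine Finset.sum_congr rfl fun π _ => ?_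
        simp only [mul_ite, ite_mul, mul_one, mul_zero, zero_mul, Finset.sum_ite_eq,
          Finset.mem_univ, if_true]
        ring
    _ ≤ ∑ π, w π * ∑ i, decrRearrange a i * decrRearrange b i :=
        Finset.sum_le_sum fun π _ => mul_le_mul_of_nonneg_left (hperm π) (hw0 π)
    _ = _ := by rw [← Finset.sum_mul, hw1, one_mul]

lemma normSq_mem_doublyStochastic {W : Matrix (Fin n) (Fin n) ℂ}
    (hW : W ∈ Matrix.unitaryGroup (Fin n) ℂ) :
    (Matrix.of fun i j => Complex.normSq (W i j)) ∈ doublyStochastic ℝ (Fin n) := by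
  refine mem_doublyStochastic_iff_sum.2 ⟨fun i j => Complex.normSq_nonneg _, fun i => ?_,
    fun j => ?_⟩
  · have h := congrFun (congrFun (Matrix.mem_unitaryGroup_iff.1 hW) i) i
    simp only [Matrix.mul_apply, Matrix.star_apply, Matrix.one_apply_eq, RCLike.star_def,
      Complex.mul_conj] at h
    exact_mod_cast h
  · have h := congrFun (congrFun (Matrix.mem_unitaryGroup_iff'.1 hW) j) j
    simp only [Matrix.mul_apply, Matrix.star_apply, Matrix.one_apply_eq, RCLike.star_def,
      ← Complex.normSq_eq_conj_mul_self] at h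
    exact_mod_cast h

lemma trace_diagonal_conj (a b : Fin n → ℝ) (W : Matrix (Fin n) (Fin n) ℂ) :
    (Matrix.trace (Matrix.diagonal (RCLike.ofReal ∘ a) * (W *
      Matrix.diagonal (RCLike.ofReal ∘ b) * star W))).re =
      ∑ i, ∑ j, a i * Complex.normSq (W i j) * b j := by
  have : Matrix.trace (Matrix.diagonal (RCLike.ofReal ∘ a) * (W *
      Matrix.diagonal (RCLike.ofReal ∘ b) * star W)) =
      ((∑ i, ∑ j, a i * Complex.normSq (W i j) * b j : ℝ) : ℂ) := by
    push_cast
    simp only [Matrix.trace, Matrix.diag_apply, Matrix.diagonal_mul]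
    refine Finset.sum_congr rfl fun i _ => ?_
    rw [Matrix.mul_apply, Finset.mul_sum]
    refine Finset.sum_congr rfl fun j _ => ?_
    simp only [Matrix.mul_diagonal, Matrix.star_apply, RCLike.star_def, ← Complex.mul_conj,
      Function.comp_apply, Complex.coe_algebraMap]
    ring
  rw [this, Complex.ofReal_re]

/-- Von Neumann's trace inequality for Hermitian matrices. -/
lemma re_trace_mul_le {A B : Matrix (Fin n) (Fin n) ℂ} (hA : A.IsHermitian)
    (hB : B.IsHermitian) :
    (Matrix.trace (A * B)).re ≤ ∑ i, absSpecVec A i * absSpecVec B i := by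
  let U := hA.eigenvectorUnitary
  let V := hB.eigenvectorUnitary
  let W : Matrix.unitaryGroup (Fin n) ℂ := star U * V
  have htr : Matrix.trace (A * B) = Matrix.trace
      (Matrix.diagonal (RCLike.ofReal ∘ hA.eigenvalues) * ((W : Matrix (Fin n) (Fin n) ℂ) *
      Matrix.diagonal (RCLike.ofReal ∘ hB.eigenvalues) *
        star (W : Matrix (Fin n) (Fin n) ℂ))) := by
    conv_lhs => rw [hA.spectral_theorem, hB.spectral_theorem]
    simp only [Unitary.conjStarAlgAut_apply, W, U, V, Submonoid.coe_mul, Unitary.coe_star,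
      star_mul, star_star, Matrix.mul_assoc]
    rw [Matrix.trace_mul_comm]
    simp only [Matrix.mul_assoc]
  rw [htr, trace_diagonal_conj, absSpecVec_eq hA, absSpecVec_eq hB]
  refine le_trans ?_ (sum_doublyStochastic_le_of_decrRearrange
    (normSq_mem_doublyStochastic W.2) _ _)
  refine Finset.sum_le_sum fun i _ => Finset.sum_le_sum fun j _ => ?_
  rw [Matrix.of_apply, mul_right_comm, mul_right_comm |_|, ← abs_mul]
  exact mul_le_mul_of_nonneg_right (le_abs_self _) (Complex.normSq_nonneg _)

/-- The sum of the absolute values of the eigenvalues indexed by `K` is attained by pairing with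
a Hermitian partial isometry of rank at most `K.card`. -/
lemma exists_isHermitian_trace_mul_eq {A : Matrix (Fin n) (Fin n) ℂ} (hA : A.IsHermitian)
    (K : Finset (Fin n)) :
    ∃ Y : Matrix (Fin n) (Fin n) ℂ, Y.IsHermitian ∧
      (Matrix.trace (A * Y)).re = ∑ i ∈ K, |hA.eigenvalues i| ∧
      (∀ i, absSpecVec Y i ≤ 1) ∧
      (Finset.univ.filter fun i => absSpecVec Y i ≠ 0).card ≤ K.card := by
  let d : Fin n → ℝ := fun i => if i ∈ K then (SignType.sign (hA.eigenvalues i) : ℝ) else 0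
  let D : Matrix (Fin n) (Fin n) ℂ := Matrix.diagonal (RCLike.ofReal ∘ d)
  have hY : (Unitary.conjStarAlgAut ℂ _ hA.eigenvectorUnitary D).IsHermitian := by
    rw [Matrix.IsHermitian, ← Matrix.star_eq_conjTranspose, ← map_star,
      Matrix.star_eq_conjTranspose, Matrix.diagonal_conjTranspose]
    congr 2
    ext i
    simp
  obtain ⟨σ, hσ⟩ := exists_perm_absSpecVec hY
  refine ⟨_, hY, ?_, fun i => ?_, ?_⟩
  · have htr : Matrix.trace (A * Unitary.conjStarAlgAut ℂ _ hA.eigenvectorUnitary D) =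
        Matrix.trace (Matrix.diagonal (RCLike.ofReal ∘ hA.eigenvalues) * D) := by
      refine (congrArg (fun B => Matrix.trace (B * _)) hA.spectral_theorem).trans ?_
      rw [← map_mul, Unitary.conjStarAlgAut_apply, Matrix.trace_mul_comm, ← Matrix.mul_assoc,
        Unitary.coe_star_mul_self, Matrix.one_mul]
    rw [htr, Matrix.diagonal_mul_diagonal, Matrix.trace_diagonal, Complex.re_sum,
      ← Finset.univ_inter K, ← Finset.sum_ite_mem]
    refine Finset.sum_congr rfl fun i _ => ?_
    simp only [Function.comp_apply, d]
    split_ifs <;> simp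
  · rw [hσ]
    have hmem : ((hY.eigenvalues (σ i) : ℝ) : ℂ) ∈ spectrum ℂ
        (Unitary.conjStarAlgAut ℂ _ hA.eigenvectorUnitary D) := by
      rw [hY.spectrum_eq_image_range]
      exact ⟨_, ⟨_, rfl⟩, rfl⟩
    rw [AlgEquiv.spectrum_eq, spectrum_diagonal] at hmem
    obtain ⟨j, hj⟩ := hmem
    have hj : d j = hY.eigenvalues (σ i) := by simpa using hj
    rw [← hj]
    simp only [d]
    split_ifs
    · rcases lt_trichotomy (hA.eigenvalues j) 0 with h | h | h <;> simp [h]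
    · simp
  · calc (Finset.univ.filter fun i => absSpecVec _ i ≠ 0).card
        = Fintype.card {i // hY.eigenvalues i ≠ 0} := by
          rw [← Fintype.card_subtype]
          exact Fintype.card_congr (σ.subtypeEquiv fun i => by rw [hσ i, abs_ne_zero])
      _ = (Unitary.conjStarAlgAut ℂ _ hA.eigenvectorUnitary D).rank :=
          hY.rank_eq_card_non_zero_eigs.symm
      _ ≤ D.rank := by
          rw [Unitary.conjStarAlgAut_apply]
          exact (Matrix.rank_mul_le_left _ _).trans (Matrix.rank_mul_le_right _ _)
      _ = (Finset.univ.filter fun i => (RCLike.ofReal ∘ d : Fin n → ℂ) i ≠ 0).card := by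
          rw [Matrix.rank_diagonal, Fintype.card_subtype]
      _ ≤ K.card := Finset.card_le_card fun i hi => by
          by_contra h
          simp [d, h] at hi

end WeakMajorization

/-- A weak majorization bound is equivalent to a bound on the associated bilinear form, which is
symmetric in its two arguments. -/
lemma weakMaj_iff_re_trace_mul_le {n : ℕ} {T : Matrix (Fin n) (Fin n) ℂ → Matrix (Fin n) (Fin n) ℂ}
    (hT : ∀ X : Matrix (Fin n) (Fin n) ℂ, X.IsHermitian → (T X).IsHermitian)
    {q : Fin n → ℝ} (hq : DecrNonneg q) :
    (∀ X : Matrix (Fin n) (Fin n) ℂ, X.IsHermitian →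
      WeakMaj (absSpecVec (T X)) (q * absSpecVec X)) ↔
    ∀ X Y : Matrix (Fin n) (Fin n) ℂ, X.IsHermitian → Y.IsHermitian →
      (Matrix.trace (T X * Y)).re ≤ ∑ i, q i * absSpecVec X i * absSpecVec Y i := by
  constructor
  · intro h X Y hX hY
    exact (re_trace_mul_le (hT X hX) hY).trans (sum_mul_le_sum_mul_of_weakMaj
      (hq.mul (decrNonneg_absSpecVec hX)).1 (decrNonneg_absSpecVec hY) (h X hX))
  · intro h X hX k _ hk
    refine sumLargest_le hk fun A hA => ?_
    obtain ⟨σ, hσ⟩ := exists_perm_absSpecVec (hT X hX)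
    obtain ⟨Y, hY, htr, hle, hcard⟩ :=
      exists_isHermitian_trace_mul_eq (hT X hX) (A.map σ.toEmbedding)
    rw [Finset.card_map, hA] at hcard
    calc ∑ i ∈ A, absSpecVec (T X) i = (Matrix.trace (T X * Y)).re := by
          simp [htr, Finset.sum_map, hσ]
      _ ≤ ∑ i, (q * absSpecVec X) i * absSpecVec Y i := h X Y hX hY
      _ ≤ sumLargest (q * absSpecVec X) k := sum_mul_le_sumLargest hk
          (hq.mul (decrNonneg_absSpecVec hX)).2 hle hcard

theorem weak_majorization_ineq_adjoint_iff (n : ℕ) (T T' : Matrix (Fin n) (Fin n) ℂ → Matrix (Fin n) (Fin n) ℂ)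
    (hTlin : IsLinearMap ℝ T) (hT'lin : IsLinearMap ℝ T')
    (hT : ∀ X : Matrix (Fin n) (Fin n) ℂ, X.IsHermitian → (T X).IsHermitian)
    (hT' : ∀ X : Matrix (Fin n) (Fin n) ℂ, X.IsHermitian → (T' X).IsHermitian)
    (hadj : IsAdjointOf T' T)
    (q : Fin n → ℝ) (hq : DecrNonneg q) :
    (∀ X : Matrix (Fin n) (Fin n) ℂ, X.IsHermitian →
      WeakMaj (absSpecVec (T X)) (q * absSpecVec X)) ↔
    (∀ X : Matrix (Fin n) (Fin n) ℂ, X.IsHermitian →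
      WeakMaj (absSpecVec (T' X)) (q * absSpecVec X)) := by
  rw [weakMaj_iff_re_trace_mul_le hT hq, weakMaj_iff_re_trace_mul_le hT' hq]
  constructor
  · intro h X Y hX hY
    rw [Matrix.trace_mul_comm, ← hadj Y X hY hX]
    simpa only [mul_right_comm] using h Y X hY hX
  · intro h X Y hX hY
    rw [hadj X Y hX hY, Matrix.trace_mul_comm]
    simpa only [mul_right_comm] using h Y X hY hX
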